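/- arXiv:math/0402399 — 6 statements merged into one kernel-verified Lean document; each statement's English description precedes it below -/
import Mathlib

section
/- For all real numbers a > 0 and b > 0, setting r = sqrt(a^2 + b^2), one has ∫_0^1 (x(1-x))^{-1/2} / (a·sqrt(x) + b·sqrt(1-x)) dx = (1/r) · log( ((r+a)(r+b)) / ((r-a)(r-b)) ). (Note that r > a and r > b, so the argument of the logarithm is positive.) -/
open MeasureTheory Real

/-- Closed-form evaluation of the integral `I(a,b)` from Proposition 5.6 of
Aldous–Pitman, "Two recursive decompositions of Brownian bridge". -/
theorem stmt_0 (a b : ℝ) (ha : 0 < a) (hb : 0 < b) (r : ℝ)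
    (hr : r = Real.sqrt (a ^ 2 + b ^ 2)) :
    ∫ x in (0:ℝ)..1,
        (x * (1 - x)) ^ (-(1:ℝ)/2) / (a * Real.sqrt x + b * Real.sqrt (1 - x)) =
      (1 / r) * Real.log (((r + a) * (r + b)) / ((r - a) * (r - b))) := by
  have hr2 : r ^ 2 = a ^ 2 + b ^ 2 := by rw [hr]; exact Real.sq_sqrt (by positivity)
  have hr0 : 0 < r := by rw [hr]; positivity
  have hra : a < r := by nlinarith
  have hrb : b < r := by nlinarith
  have hw : ∀ x ∈ Set.Icc (0:ℝ) 1, 0 < r + (b * √x - a * √(1 - x)) ∧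
      0 < r - (b * √x - a * √(1 - x)) := by
    rintro x ⟨h0, h1⟩
    have h2 : √x ≤ 1 := Real.sqrt_le_one.mpr h1
    have h3 : √(1 - x) ≤ 1 := Real.sqrt_le_one.mpr (by linarith)
    have h4 := Real.sqrt_nonneg x
    have h5 := Real.sqrt_nonneg (1 - x)
    constructor <;> nlinarith
  let F : ℝ → ℝ := fun x => (1 / r) * (Real.log (r + (b * √x - a * √(1 - x))) -
    Real.log (r - (b * √x - a * √(1 - x))))
  have hcont : ContinuousOn F (Set.Icc 0 1) := by
    refine ContinuousOn.mul continuousOn_const (ContinuousOn.sub ?_ ?_)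
    · exact ContinuousOn.log (by fun_prop) fun x hx => (hw x hx).1.ne'
    · exact ContinuousOn.log (by fun_prop) fun x hx => (hw x hx).2.ne'
  have hpow : ∀ x ∈ Set.Ioo (0:ℝ) 1, (x * (1 - x)) ^ (-(1:ℝ)/2) = 1 / (√x * √(1 - x)) := by
    rintro x ⟨h0, h1⟩
    have : 0 ≤ x * (1 - x) := mul_nonneg h0.le (by linarith)
    rw [neg_div, Real.rpow_neg this, ← Real.sqrt_eq_rpow, Real.sqrt_mul h0.le, one_div]
  have hderiv : ∀ x ∈ Set.Ioo (0:ℝ) 1, HasDerivAt F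
      ((x * (1 - x)) ^ (-(1:ℝ)/2) / (a * Real.sqrt x + b * Real.sqrt (1 - x))) x := by
    intro x hx
    obtain ⟨p1, p2⟩ := hw x ⟨hx.1.le, hx.2.le⟩
    rw [hpow x hx]
    obtain ⟨h0, h1⟩ := hx
    have h1' : 0 < 1 - x := by linarith
    have d1 := Real.hasDerivAt_sqrt h0.ne'
    have d2 := ((hasDerivAt_id x).const_sub 1).sqrt h1'.ne'
    have dw := (d1.const_mul b).sub (d2.const_mul a)
    have dF := (((dw.const_add r).log p1.ne').sub ((dw.const_sub r).log p2.ne')).const_mul (1 / r)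
    refine dF.congr_deriv ?_
    simp only [id, Pi.sub_apply]
    have s0 : 0 < √x := Real.sqrt_pos.mpr h0
    have c0 : 0 < √(1 - x) := Real.sqrt_pos.mpr h1'
    have hs : √x ^ 2 = x := Real.sq_sqrt h0.le
    have hc : √(1 - x) ^ 2 = 1 - x := Real.sq_sqrt h1'.le
    have hsc : √x ^ 2 + √(1 - x) ^ 2 = 1 := by rw [hs, hc]; ring
    generalize √x = s at *
    generalize √(1 - x) = c at *
    have hD : 0 < a * s + b * c := by positivity
    have key : (r + (b * s - a * c)) * (r - (b * s - a * c)) = (a * s + b * c) ^ 2 := by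
      linear_combination hr2 - (a ^ 2 + b ^ 2) * hsc
    have e1 : ∀ D : ℝ, D / (r + (b * s - a * c)) - (-D) / (r - (b * s - a * c))
        = D * (2 * r) / (a * s + b * c) ^ 2 := by
      intro D
      rw [← key]
      field_simp
      ring
    rw [e1]
    field_simp
    ring
  have hint := intervalIntegral.intervalIntegrable_deriv_of_nonneg (a := 0) (b := 1) (g := F)
    (by simpa using hcont) (by simpa using hderiv) (by
      intro x hx
      simp only [zero_le_one, min_eq_left, max_eq_right] at hx
      have := hx.1
      have : 0 < 1 - x := by linarith [hx.2]
      positivity)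
  rw [intervalIntegral.integral_eq_sub_of_hasDerivAt_of_le zero_le_one hcont hderiv hint]
  have q1 : 0 < r - a := by linarith
  have q2 : 0 < r - b := by linarith
  have q3 : 0 < r + a := by linarith
  have q4 : 0 < r + b := by linarith
  rw [Real.log_div (by positivity) (by positivity), Real.log_mul q3.ne' q4.ne',
    Real.log_mul q1.ne' q2.ne']
  simp only [F, Real.sqrt_one, Real.sqrt_zero, sub_zero, sub_self, mul_one, mul_zero, zero_sub,
    sub_neg_eq_add, ← sub_eq_add_neg]
  ring
end

section
/- For every x with 0 < x < 1, ∫_0^1 u(1-u) / ( 2·((1-x)u^2 + x(1-u)^2)^{3/2} ) du = (h(x) + h(1-x))/2, where h(y) := y^{-1/2} + log(y^{-1/2} - 1) for 0 < y < 1. -/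
open MeasureTheory Real

/-- The "curious formula" (taud) of Aldous–Pitman: the density of the first cut time
`T₁` of the `T`-partition of a standard Brownian bridge. -/
theorem stmt_1 (x : ℝ) (hx : 0 < x) (hx1 : x < 1) (h : ℝ → ℝ)
    (hh : ∀ y, 0 < y → y < 1 →
      h y = 1 / Real.sqrt y + Real.log (1 / Real.sqrt y - 1)) :
    ∫ u in (0:ℝ)..1,
        u * (1 - u) / (2 * ((1 - x) * u ^ 2 + x * (1 - u) ^ 2) ^ ((3:ℝ)/2)) =
      (h x + h (1 - x)) / 2 := by
  have hc : 0 < x * (1 - x) := mul_pos hx (by linarith)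
  have hQ : ∀ u : ℝ, 0 < (1 - x) * u ^ 2 + x * (1 - u) ^ 2 := by
    intro u
    nlinarith [sq_nonneg (u - x)]
  have hder : ∀ u : ℝ, HasDerivAt
      (fun u : ℝ => (1 / 2) * ((2 * (u - x) - (1 - 2 * x)) /
          √((1 - x) * u ^ 2 + x * (1 - u) ^ 2)
        - Real.log ((u - x) + √((1 - x) * u ^ 2 + x * (1 - u) ^ 2))))
      (u * (1 - u) / (2 * ((1 - x) * u ^ 2 + x * (1 - u) ^ 2) ^ ((3:ℝ)/2))) u := by
    intro u
    have hq : HasDerivAt (fun u : ℝ => (1 - x) * u ^ 2 + x * (1 - u) ^ 2) (2 * (u - x)) u := by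
      have h1 := (((hasDerivAt_id u).pow 2).const_mul (1 - x)).add
        ((((hasDerivAt_id u).const_sub 1).pow 2).const_mul x)
      refine HasDerivAt.congr_deriv (f := fun u : ℝ => (1 - x) * u ^ 2 + x * (1 - u) ^ 2) h1 ?_
      simp
      ring
    have hs := hq.sqrt (hQ u).ne'
    have hpow : ((1 - x) * u ^ 2 + x * (1 - u) ^ 2) ^ ((3:ℝ)/2)
        = (√((1 - x) * u ^ 2 + x * (1 - u) ^ 2)) ^ 3 := by
      have hp := (hQ u).le
      generalize (1 - x) * u ^ 2 + x * (1 - u) ^ 2 = q at hp ⊢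
      rw [Real.sqrt_eq_rpow, ← Real.rpow_natCast, ← Real.rpow_mul hp]
      norm_num
    have hspos := Real.sqrt_pos.2 (hQ u)
    have hsq := Real.sq_sqrt (hQ u).le
    have hv : 0 < (u - x) + √((1 - x) * u ^ 2 + x * (1 - u) ^ 2) := by
      by_contra hn
      nlinarith
    have hd : HasDerivAt (fun u : ℝ => u - x) 1 u := (hasDerivAt_id u).sub_const x
    have hn : HasDerivAt (fun u : ℝ => 2 * (u - x) - (1 - 2 * x)) 2 u := by
      simpa using (hd.const_mul 2).sub_const (1 - 2 * x)
    have key := ((hn.div hs hspos.ne').sub ((hd.add hs).log hv.ne')).const_mul (1 / 2)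
    refine key.congr_deriv ?_
    rw [hpow]
    simp only [Pi.add_apply]
    generalize √((1 - x) * u ^ 2 + x * (1 - u) ^ 2) = s at *
    have e1 : (1 + 2 * (u - x) / (2 * s)) / (u - x + s) = 1 / s := by
      field_simp
      ring
    rw [e1]
    field_simp
    linear_combination (1 : ℝ) * hsq
  have hcont : Continuous (fun u : ℝ =>
      u * (1 - u) / (2 * ((1 - x) * u ^ 2 + x * (1 - u) ^ 2) ^ ((3:ℝ)/2))) := by
    refine Continuous.div (by fun_prop) ?_ ?_
    · exact continuous_const.mul (Continuous.rpow_const (by fun_prop) (fun u => Or.inr (by norm_num)))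
    · intro u
      have := Real.rpow_pos_of_pos (hQ u) ((3:ℝ)/2)
      positivity
  rw [intervalIntegral.integral_eq_sub_of_hasDerivAt (fun u _ => hder u)
    (hcont.intervalIntegrable _ _), hh x hx hx1, hh (1 - x) (by linarith) (by linarith)]
  have ha := Real.sqrt_pos.2 hx
  have hb := Real.sqrt_pos.2 (sub_pos.2 hx1)
  have ha2 := Real.sq_sqrt hx.le
  have hb2 := Real.sq_sqrt (sub_pos.2 hx1).le
  have q1 : (1 - x) * (1:ℝ) ^ 2 + x * (1 - 1) ^ 2 = 1 - x := by ring
  have q0 : (1 - x) * (0:ℝ) ^ 2 + x * (1 - 0) ^ 2 = x := by ring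
  simp only [q1, q0]
  generalize √x = a at *
  generalize √(1 - x) = b at *
  have ha1 : a < 1 := by nlinarith
  have hb1 : b < 1 := by nlinarith
  have l1 : (1 - x) + b = b * (1 + b) := by rw [← hb2]; ring
  have l0 : (0 - x) + a = a * (1 - a) := by rw [← ha2]; ring
  have l2 : 1 / a - 1 = (1 - a) / a := by field_simp
  have l3 : 1 / b - 1 = (1 - b) / b := by field_simp
  have l4 : Real.log (1 - b) + Real.log (1 + b) = 2 * Real.log a := by
    rw [← Real.log_mul (by linarith) (by linarith)]
    have : (1 - b) * (1 + b) = a ^ 2 := by nlinarith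
    rw [this, Real.log_pow]
    norm_num
  rw [l1, l0, l2, l3, Real.log_mul hb.ne' (by linarith), Real.log_mul ha.ne' (by linarith),
    Real.log_div (by linarith) ha.ne', Real.log_div (by linarith) hb.ne']
  have m1 : (2 * (1 - x) - (1 - 2 * x)) = 1 := by ring
  have m0 : (2 * (0 - x) - (1 - 2 * x)) = -1 := by ring
  rw [m1, m0, neg_div]
  linear_combination (-1 / 2) * l4
end

section
/- For every u and x with 0 < u < 1 and 0 < x < 1, sqrt(2π) · ∫_0^∞ f_{uℓ}(x) · f_{(1-u)ℓ}(1-x) dℓ = u(1-u) / ( 2·((1-x)u^2 + x(1-u)^2)^{3/2} ). -/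
open MeasureTheory Real

/-- Lévy's density of the stable(1/2) subordinator at local-time level `ℓ`:
the density of the first passage time of Brownian motion to level `ℓ`. -/
noncomputable def levyDensity (ℓ t : ℝ) : ℝ :=
  if 0 < t then ℓ / Real.sqrt (2 * π) * t ^ (-(3:ℝ)/2) * Real.exp (-ℓ ^ 2 / (2 * t)) else 0

theorem aux_rp {y : ℝ} (hy : 0 < y) : y ^ ((3:ℝ)/2) = y * √y := by
  rw [show (3:ℝ)/2 = 1 + 1/2 by norm_num, rpow_add hy, rpow_one, sqrt_eq_rpow]

theorem aux_rn {y : ℝ} (hy : 0 < y) : y ^ (-(3:ℝ)/2) = (y * √y)⁻¹ := by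
  rw [show -(3:ℝ)/2 = -(3/2) by norm_num, rpow_neg hy.le, aux_rp hy]

/-- Formula (fxu) of Aldous–Pitman: the density of the inverse normalized bridge
local time `τ^br_u`, obtained by integrating out the total local time `ℓ`. -/
theorem stmt_2 (u x : ℝ) (hu : 0 < u) (hu1 : u < 1) (hx : 0 < x) (hx1 : x < 1) :
    Real.sqrt (2 * π) *
        ∫ ℓ in Set.Ioi (0:ℝ), levyDensity (u * ℓ) x * levyDensity ((1 - u) * ℓ) (1 - x) =
      u * (1 - u) / (2 * ((1 - x) * u ^ 2 + x * (1 - u) ^ 2) ^ ((3:ℝ)/2)) := by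
  have hv : 0 < 1 - u := by linarith
  have hy : 0 < 1 - x := by linarith
  generalize 1 - u = v at *
  generalize 1 - x = y at *
  have hD : 0 < y * u ^ 2 + x * v ^ 2 := by positivity
  obtain ⟨D, hDe⟩ : ∃ D, D = y * u ^ 2 + x * v ^ 2 := ⟨_, rfl⟩
  rw [← hDe] at hD ⊢
  have hb : 0 < D / (2 * (x * y)) := by positivity
  have key : ∀ l ∈ Set.Ioi (0:ℝ), levyDensity (u * l) x * levyDensity (v * l) y =
      (u * v / (2 * π) * (x * √x)⁻¹ * (y * √y)⁻¹) *
        (l ^ (2:ℝ) * exp (-(D / (2 * (x * y))) * l ^ (2:ℝ))) := by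
    intro l _
    have he : exp (-(D / (2 * (x * y))) * l ^ 2) =
        exp (-(u * l) ^ 2 / (2 * x)) * exp (-(v * l) ^ 2 / (2 * y)) := by
      rw [← exp_add, hDe]
      congr 1
      field_simp
      ring
    have hs : √(2 * π) * √(2 * π) = 2 * π := mul_self_sqrt (by positivity)
    rw [levyDensity, levyDensity, if_pos hx, if_pos hy, aux_rn hx, aux_rn hy, rpow_two, he, ← hs]
    field_simp
    rw [sqrt_sq (sqrt_nonneg _)]
  rw [setIntegral_congr_fun measurableSet_Ioi key, integral_const_mul,
    integral_rpow_mul_exp_neg_mul_rpow (by norm_num) (by norm_num) hb,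
    show (-((2:ℝ) + 1) / 2) = -(3:ℝ)/2 by norm_num, aux_rn hb, aux_rp hD,
    show (((2:ℝ) + 1) / 2) = 1/2 + 1 by norm_num, Gamma_add_one (by norm_num),
    Gamma_one_half_eq, sqrt_div hD.le, sqrt_mul (by norm_num), sqrt_mul (by norm_num),
    sqrt_mul hx.le]
  have h2 : √2 ^ 2 = (2:ℝ) := sq_sqrt (by norm_num)
  have hp : √π ^ 2 = π := sq_sqrt pi_pos.le
  have := pi_pos
  field_simp
  rw [h2, hp]
  try ring
end

section
/- For all y > 0, v > 0 and x > 0, ∫_0^x s · f_y(s) · f_v(x - s) ds = ( x·y/(y+v) ) · f_{y+v}(x). -/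
open MeasureTheory Real

open Filter Topology Set

theorem aux_ftc {a b la lb : ℝ} (hab : a < b) {F g : ℝ → ℝ}
    (hd : ∀ s ∈ Ioo a b, HasDerivAt F (g s) s) (hn : ∀ s ∈ Ioo a b, 0 ≤ g s)
    (ha : Tendsto F (𝓝[>] a) (𝓝 la)) (hb : Tendsto F (𝓝[<] b) (𝓝 lb)) :
    ∫ s in a..b, g s = lb - la := by
  have hc : ContinuousOn F (Ioo a b) := fun s hs => (hd s hs).continuousAt.continuousWithinAt
  apply intervalIntegral.integral_eq_sub_of_hasDerivAt_of_tendsto hab hd _ ha hb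
  rw [intervalIntegrable_iff_integrableOn_Ioc_of_le hab.le]
  refine intervalIntegral.integrableOn_deriv_of_nonneg
    (continuousOn_Icc_extendFrom_Ioo hc ha hb) (fun s hs => ?_) hn
  refine (hd s hs).congr_of_eventuallyEq ?_
  filter_upwards [Ioo_mem_nhds hs.1 hs.2] with t ht
  exact extendFrom_extends hc t ht

noncomputable def auxPhi (b z : ℝ) : ℝ := ∫ t in (0:ℝ)..z, Real.exp (-b * t ^ 2)

theorem auxPhi_deriv (b z : ℝ) : HasDerivAt (auxPhi b) (Real.exp (-b * z ^ 2)) z := by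
  have hc : Continuous (fun t : ℝ => Real.exp (-b * t ^ 2)) := by fun_prop
  exact intervalIntegral.integral_hasDerivAt_right (hc.intervalIntegrable _ _)
    (hc.stronglyMeasurableAtFilter _ _) hc.continuousAt

theorem auxPhi_top {b : ℝ} (hb : 0 < b) :
    Tendsto (auxPhi b) atTop (𝓝 (√(π / b) / 2)) := by
  rw [← integral_gaussian_Ioi]
  exact intervalIntegral_tendsto_integral_Ioi 0 (integrable_exp_neg_mul_sq hb).integrableOn
    tendsto_id

theorem auxPhi_neg (b z : ℝ) : auxPhi b (-z) = - auxPhi b z := by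
  have h := intervalIntegral.integral_comp_neg (a := 0) (b := z)
    (fun t : ℝ => Real.exp (-b * t ^ 2))
  simp only [neg_sq, neg_zero] at h
  unfold auxPhi
  rw [h, intervalIntegral.integral_symm]

theorem auxPhi_bot {b : ℝ} (hb : 0 < b) :
    Tendsto (auxPhi b) atBot (𝓝 (-(√(π / b) / 2))) := by
  have h := ((auxPhi_top hb).comp tendsto_neg_atBot_atTop).neg
  refine h.congr fun z => ?_
  simp [auxPhi_neg]

theorem aux_rpow {s : ℝ} (hs : 0 < s) : s ^ (-(3:ℝ)/2) = 1 / (√s) ^ 3 := by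
  rw [Real.sqrt_eq_rpow, ← Real.rpow_natCast, ← Real.rpow_mul hs.le, one_div, ← Real.rpow_neg hs.le]
  norm_num

theorem aux_lim (x c d : ℝ) (hx : 0 < x) (hd : 0 < d) :
    Tendsto (fun s => c * (√s / √(x - s)) + d * (√(x - s) / √s)) (𝓝[>] 0) atTop := by
  have hq : Tendsto (fun s : ℝ => √(x - s)) (𝓝[>] 0) (𝓝 (√x)) := by
    have : Continuous (fun s : ℝ => √(x - s)) := by fun_prop
    simpa using (this.tendsto 0).mono_left nhdsWithin_le_nhds
  have hp : Tendsto (fun s : ℝ => √s) (𝓝[>] 0) (𝓝 0) := by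
    simpa using (Real.continuous_sqrt.tendsto 0).mono_left nhdsWithin_le_nhds
  have hp' : Tendsto (fun s : ℝ => √s) (𝓝[>] 0) (𝓝[>] 0) := by
    rw [tendsto_nhdsWithin_iff]
    refine ⟨hp, ?_⟩
    filter_upwards [self_mem_nhdsWithin] with s hs
    exact Real.sqrt_pos.2 hs
  have hx' := Real.sqrt_pos.2 hx
  have h1 := (hp.div hq hx'.ne').const_mul c
  have h2 := (hq.pos_mul_atTop hx' hp'.inv_tendsto_nhdsGT_zero).const_mul_atTop hd
  exact h1.add_atTop h2

theorem aux_lim' (x c d : ℝ) (hx : 0 < x) (hc : 0 < c) :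
    Tendsto (fun s => c * (√s / √(x - s)) + d * (√(x - s) / √s)) (𝓝[<] x) atTop := by
  have h : Tendsto (fun s : ℝ => x - s) (𝓝[<] x) (𝓝[>] 0) := by
    rw [tendsto_nhdsWithin_iff]
    constructor
    · have : Continuous (fun s : ℝ => x - s) := by fun_prop
      simpa using (this.tendsto x).mono_left nhdsWithin_le_nhds
    · filter_upwards [self_mem_nhdsWithin] with s hs
      exact sub_pos.2 (mem_Iio.1 hs)
  refine ((aux_lim x d c hx hc).comp h).congr fun s => ?_
  simp only [Function.comp, sub_sub_cancel]
  ring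

theorem aux_main (y v x : ℝ) (hx : 0 < x) (s : ℝ) (hs : s ∈ Ioo 0 x) :
    HasDerivAt (fun s => y * Real.exp (-(y + v) ^ 2 / (2 * x)) / (π * x) * (1 / 2) *
      (auxPhi (1 / (2 * x)) (v * (√s / √(x - s)) + (-y) * (√(x - s) / √s))
      + Real.exp (2 * v * y / x) *
        auxPhi (1 / (2 * x)) (v * (√s / √(x - s)) + y * (√(x - s) / √s))))
      (s * levyDensity y s * levyDensity v (x - s)) s := by
  have hs0 : 0 < s := hs.1
  have hs1 : 0 < x - s := sub_pos.2 hs.2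
  have hp := Real.sqrt_pos.2 hs0
  have hq := Real.sqrt_pos.2 hs1
  have dp : HasDerivAt (fun s : ℝ => √s) (1 / (2 * √s)) s := Real.hasDerivAt_sqrt hs0.ne'
  have dq : HasDerivAt (fun s : ℝ => √(x - s)) ((-1) / (2 * √(x - s))) s :=
    ((hasDerivAt_id s).const_sub x).sqrt hs1.ne'
  have d1 := dp.div dq hq.ne'
  have d2 := dq.div dp hp.ne'
  have e1 := (auxPhi_deriv (1 / (2 * x)) _).comp s ((d1.const_mul v).add (d2.const_mul (-y)))
  have e2 := (auxPhi_deriv (1 / (2 * x)) _).comp s ((d1.const_mul v).add (d2.const_mul y))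
  have e := (e1.add (e2.const_mul (Real.exp (2 * v * y / x)))).const_mul
    (y * Real.exp (-(y + v) ^ 2 / (2 * x)) / (π * x) * (1 / 2))
  refine HasDerivAt.congr_deriv e ?_
  simp only [Pi.add_apply, Pi.div_apply]
  unfold levyDensity
  rw [if_pos hs0, if_pos hs1, aux_rpow hs0, aux_rpow hs1]
  have hs2 : √s ^ 2 = s := Real.sq_sqrt hs0.le
  have hq2 : √(x - s) ^ 2 = x - s := Real.sq_sqrt hs1.le
  have hpi : √(2 * π) ^ 2 = 2 * π := Real.sq_sqrt (by positivity)
  have hpi0 : 0 < √(2 * π) := Real.sqrt_pos.2 (by positivity)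
  generalize √s = p at *
  generalize √(x - s) = q at *
  generalize √(2 * π) = k at *
  clear e e1 e2 d1 d2 dp dq
  have hxp : x = p ^ 2 + q ^ 2 := by linarith
  have hxs : x - s = q ^ 2 := hq2.symm
  have hpik : π = k ^ 2 / 2 := by linarith
  rw [hxs, ← hs2, hpik]
  clear hs2 hq2 hpi hpik hxs hs hs0 hs1
  have hE : Real.exp (2 * v * y / x) *
      Real.exp (-(1 / (2 * x)) * (v * (p / q) + y * (q / p)) ^ 2) =
      Real.exp (-(1 / (2 * x)) * (v * (p / q) + -y * (q / p)) ^ 2) := by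
    rw [← Real.exp_add]
    congr 1
    field_simp
    ring
  have hE2 : Real.exp (-y ^ 2 / (2 * p ^ 2)) * Real.exp (-v ^ 2 / (2 * q ^ 2)) =
      Real.exp (-(y + v) ^ 2 / (2 * x)) *
      Real.exp (-(1 / (2 * x)) * (v * (p / q) + -y * (q / p)) ^ 2) := by
    rw [← Real.exp_add, ← Real.exp_add]
    congr 1
    subst hxp
    field_simp
    ring
  rw [← mul_assoc (Real.exp (2 * v * y / x)), hE]
  trans (y * v / (k ^ 2 * p * q ^ 3)) *
    (Real.exp (-(y + v) ^ 2 / (2 * x)) *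
      Real.exp (-(1 / (2 * x)) * (v * (p / q) + -y * (q / p)) ^ 2))
  · generalize Real.exp (-(y + v) ^ 2 / (2 * x)) = A
    generalize Real.exp (-(1 / (2 * x)) * (v * (p / q) + -y * (q / p)) ^ 2) = B
    subst hxp
    field_simp
    ring
  · rw [← hE2]
    field_simp

/-- Density form of `E[τ_y/(τ_y+τ_v) | τ_y+τ_v] = y/(y+v)` for the stable(1/2)
subordinator, from Section 6.4 of Aldous–Pitman. -/
theorem stmt_7 (y v x : ℝ) (hy : 0 < y) (hv : 0 < v) (hx : 0 < x) :
    ∫ s in (0:ℝ)..x, s * levyDensity y s * levyDensity v (x - s) =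
      x * y / (y + v) * levyDensity (y + v) x := by
  have hb : 0 < 1 / (2 * x) := by positivity
  have l1 : Tendsto (fun s => v * (√s / √(x - s)) + (-y) * (√(x - s) / √s)) (𝓝[>] 0) atBot := by
    refine (tendsto_neg_atTop_atBot.comp (aux_lim x (-v) y hx hy)).congr fun s => ?_
    simp only [Function.comp]
    ring
  have ha := (((auxPhi_bot hb).comp l1).add
    (((auxPhi_top hb).comp (aux_lim x v y hx hy)).const_mul (Real.exp (2 * v * y / x)))).const_mul
    (y * Real.exp (-(y + v) ^ 2 / (2 * x)) / (π * x) * (1 / 2))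
  have hb' := (((auxPhi_top hb).comp (aux_lim' x v (-y) hx hv)).add
    (((auxPhi_top hb).comp (aux_lim' x v y hx hv)).const_mul (Real.exp (2 * v * y / x)))).const_mul
    (y * Real.exp (-(y + v) ^ 2 / (2 * x)) / (π * x) * (1 / 2))
  have hn : ∀ s ∈ Ioo 0 x, 0 ≤ s * levyDensity y s * levyDensity v (x - s) := by
    intro s hs
    have hs0 : 0 < s := hs.1
    have hs1 : 0 < x - s := sub_pos.2 hs.2
    unfold levyDensity
    rw [if_pos hs0, if_pos hs1]
    positivity
  rw [aux_ftc hx (aux_main y v x hx) hn ha hb']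
  unfold levyDensity
  rw [if_pos hx, aux_rpow hx]
  have h1 : √(π / (1 / (2 * x))) = √(2 * π) * √x := by
    rw [← Real.sqrt_mul (by positivity)]
    congr 1
    field_simp
  rw [h1]
  have hx2 : √x ^ 2 = x := Real.sq_sqrt hx.le
  have hx0 := Real.sqrt_pos.2 hx
  have hpi : √(2 * π) ^ 2 = 2 * π := Real.sq_sqrt (by positivity)
  have hpi0 : 0 < √(2 * π) := Real.sqrt_pos.2 (by positivity)
  have hpik : π = √(2 * π) ^ 2 / 2 := by linarith
  generalize Real.exp (-(y + v) ^ 2 / (2 * x)) = A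
  generalize √(2 * π) = k at *
  generalize √x = r at *
  rw [hpik]
  subst hx2
  field_simp
  ring
end

section
/- For all a > 0 and x > 0, ∫_0^x (a/(2π)) · y^{-3/2} · (x - y)^{-1/2} · exp(−a^2/(2y)) dy = (2πx)^{-1/2} · exp(−a^2/(2x)). Equivalently, ∫_0^x f_a(y) · ρ(x−y) · (x−y) dy = (x/a) · f_a(x), where ρ(s) = (2π)^{-1/2} s^{-3/2} is the Lévy density of the stable(1/2) subordinator. -/
open MeasureTheory Real

/-- The Lévy density of the stable(1/2) subordinator. -/
noncomputable def levyMeasureDensity (s : ℝ) : ℝ := (2 * π) ^ (-(1:ℝ)/2) * s ^ (-(3:ℝ)/2)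

lemma aux_half (s : ℝ) (hs : 0 < s) : s ^ (-(1:ℝ)/2) = 1 / √s := by
  rw [neg_div, Real.rpow_neg hs.le, Real.sqrt_eq_rpow, ← one_div]

lemma aux_three (s : ℝ) (hs : 0 < s) : s ^ (-(3:ℝ)/2) = 1 / (s * √s) := by
  rw [show (-(3:ℝ)/2) = -(1 + 1/2) by norm_num, Real.rpow_neg hs.le, Real.rpow_add hs,
    Real.sqrt_eq_rpow, Real.rpow_one, ← one_div]

lemma aux_image (x : ℝ) (hx : 0 < x) :
    (fun t : ℝ => x / (1 + x * t ^ 2)) '' Set.Ioi 0 = Set.Ioo 0 x := by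
  ext y
  constructor
  · rintro ⟨t, ht, rfl⟩
    have ht : 0 < t := ht
    have : 0 < x * t ^ 2 := by positivity
    refine ⟨by positivity, ?_⟩
    show x / (1 + x * t ^ 2) < x
    rw [div_lt_iff₀ (by positivity)]
    nlinarith
  · rintro ⟨h0, h1⟩
    have hp : 0 < 1 / y - 1 / x := by
      have := one_div_lt_one_div_of_lt h0 h1
      linarith
    refine ⟨√(1 / y - 1 / x), Real.sqrt_pos.2 hp, ?_⟩
    show x / (1 + x * (√(1 / y - 1 / x)) ^ 2) = y
    rw [Real.sq_sqrt hp.le]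
    have : 1 + x * (1 / y - 1 / x) = x / y := by field_simp; ring
    rw [this]; field_simp

lemma aux_main_s8 (a x : ℝ) (ha : 0 < a) (hx : 0 < x) :
    ∫ y in (0:ℝ)..x,
        a / (2 * π) * y ^ (-(3:ℝ)/2) * (x - y) ^ (-(1:ℝ)/2) * Real.exp (-a ^ 2 / (2 * y)) =
      (2 * π * x) ^ (-(1:ℝ)/2) * Real.exp (-a ^ 2 / (2 * x)) := by
  rw [intervalIntegral.integral_of_le hx.le, integral_Ioc_eq_integral_Ioo, ← aux_image x hx]
  rw [integral_image_eq_integral_abs_deriv_smul (f' := fun t => -(2 * x ^ 2 * t) / (1 + x * t ^ 2) ^ 2)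
    measurableSet_Ioi]
  · have key : ∀ t ∈ Set.Ioi (0:ℝ), |-(2 * x ^ 2 * t) / (1 + x * t ^ 2) ^ 2| •
        (a / (2 * π) * (x / (1 + x * t ^ 2)) ^ (-(3:ℝ)/2) *
          (x - x / (1 + x * t ^ 2)) ^ (-(1:ℝ)/2) *
          Real.exp (-a ^ 2 / (2 * (x / (1 + x * t ^ 2))))) =
        (a / (π * √x) * Real.exp (-a ^ 2 / (2 * x))) * Real.exp (-(a ^ 2 / 2) * t ^ 2) := by
      intro t ht
      have ht : 0 < t := ht
      have hD : 0 < 1 + x * t ^ 2 := by positivity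
      have hxy : x - x / (1 + x * t ^ 2) = (x * t) ^ 2 / (1 + x * t ^ 2) := by
        field_simp; ring
      have hE : Real.exp (-a ^ 2 / (2 * (x / (1 + x * t ^ 2)))) =
          Real.exp (-a ^ 2 / (2 * x)) * Real.exp (-(a ^ 2 / 2) * t ^ 2) := by
        rw [← Real.exp_add]; congr 1; field_simp; ring
      rw [hE, hxy, aux_three _ (by positivity), aux_half _ (by positivity), neg_div, abs_neg,
        abs_of_pos (by positivity), Real.sqrt_div hx.le, Real.sqrt_div (by positivity),
        Real.sqrt_sq (by positivity), smul_eq_mul]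
      generalize Real.exp (-a ^ 2 / (2 * x)) = E1
      generalize Real.exp (-(a ^ 2 / 2) * t ^ 2) = E2
      have hs : √(1 + x * t ^ 2) ^ 2 = 1 + x * t ^ 2 := Real.sq_sqrt hD.le
      have hs0 : 0 < √(1 + x * t ^ 2) := Real.sqrt_pos.2 hD
      have hx0 : 0 < √x := Real.sqrt_pos.2 hx
      generalize √(1 + x * t ^ 2) = S at *
      rw [← hs]
      field_simp
    rw [setIntegral_congr_fun measurableSet_Ioi key, integral_const_mul, integral_gaussian_Ioi,
      aux_half _ (by positivity)]
    have h1 : √(π / (a ^ 2 / 2)) = √(2 * π) / a := by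
      rw [show π / (a ^ 2 / 2) = (2 * π) / a ^ 2 by field_simp, Real.sqrt_div (by positivity),
        Real.sqrt_sq ha.le]
    rw [h1, Real.sqrt_mul (by positivity) x]
    have h2 : √(2 * π) ^ 2 = 2 * π := Real.sq_sqrt (by positivity)
    have h3 : 0 < √(2 * π) := by positivity
    have hx0 : 0 < √x := Real.sqrt_pos.2 hx
    have hpi := Real.pi_pos
    generalize √(2 * π) = S at *
    field_simp
    linarith
  · intro t ht
    have ht : 0 < t := ht
    have hD : 1 + x * t ^ 2 ≠ 0 := by positivity
    have h := (hasDerivAt_const t x).div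
      ((((hasDerivAt_id t).pow 2).const_mul x).const_add 1) (by simpa using hD)
    refine HasDerivAt.hasDerivWithinAt ?_
    have e : -(2 * x ^ 2 * t) / (1 + x * t ^ 2) ^ 2 =
        (0 * (1 + x * (id ^ 2) t) - x * (x * (((2 : ℕ) : ℝ) * id t ^ (2 - 1) * 1))) /
          (1 + x * (id ^ 2) t) ^ 2 := by
      simp
      ring
    rw [← e] at h
    exact h
  · intro s hs t ht h
    have hs : 0 < s := hs
    have ht : 0 < t := ht
    have h : x / (1 + x * s ^ 2) = x / (1 + x * t ^ 2) := h
    rw [div_eq_div_iff (by positivity) (by positivity)] at h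
    have h := mul_left_cancel₀ hx.ne' h
    have h : x * s ^ 2 = x * t ^ 2 := by linarith
    have h := mul_left_cancel₀ hx.ne' h
    exact (pow_left_inj₀ hs.le ht.le two_ne_zero).1 h

theorem stmt_8 (a x : ℝ) (ha : 0 < a) (hx : 0 < x) :
    (∫ y in (0:ℝ)..x,
        a / (2 * π) * y ^ (-(3:ℝ)/2) * (x - y) ^ (-(1:ℝ)/2) * Real.exp (-a ^ 2 / (2 * y)) =
      (2 * π * x) ^ (-(1:ℝ)/2) * Real.exp (-a ^ 2 / (2 * x))) ∧
    ∫ y in (0:ℝ)..x, levyDensity a y * levyMeasureDensity (x - y) * (x - y) =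
      x / a * levyDensity a x := by
  refine ⟨aux_main_s8 a x ha hx, ?_⟩
  have h2 : √(2 * π) ^ 2 = 2 * π := Real.sq_sqrt (by positivity)
  have h3 : 0 < √(2 * π) := by positivity
  have hR : x / a * levyDensity a x =
      (2 * π * x) ^ (-(1:ℝ)/2) * Real.exp (-a ^ 2 / (2 * x)) := by
    have hx0 : 0 < √x := Real.sqrt_pos.2 hx
    rw [levyDensity, if_pos hx, aux_three x hx, aux_half _ (by positivity),
      Real.sqrt_mul (by positivity) x]
    field_simp
  rw [hR, ← aux_main_s8 a x ha hx, intervalIntegral.integral_of_le hx.le,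
    intervalIntegral.integral_of_le hx.le, integral_Ioc_eq_integral_Ioo,
    integral_Ioc_eq_integral_Ioo]
  refine setIntegral_congr_fun measurableSet_Ioo ?_
  rintro y ⟨h0, h1⟩
  have hs : 0 < x - y := sub_pos.2 h1
  have hs0 : 0 < √(x - y) := Real.sqrt_pos.2 hs
  show levyDensity a y * levyMeasureDensity (x - y) * (x - y) = _
  rw [levyDensity, if_pos h0, levyMeasureDensity]
  simp only
  rw [aux_three (x - y) hs, aux_half (x - y) hs, aux_half (2 * π) (by positivity), ← h2]
  rw [Real.sqrt_sq h3.le]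
  field_simp
end

section
/- For n ≥ 1 and a mapping M : {1,...,n} → {1,...,n}, call i a cyclic point of M if M^k(i) = i for some k ≥ 1 (where M^k is the k-th iterate of M). Fix a nonempty subset C of {1,...,n}. For a permutation σ of C, let N(C, σ) be the number of mappings M : {1,...,n} → {1,...,n} whose set of cyclic points is exactly C and whose restriction to C equals σ. Then N(C, σ) = N(C, σ') for any two permutations σ, σ' of C; moreover N(C, σ) depends only on n and the cardinality |C|, i.e. N(C, σ) = N(C', σ'') whenever |C| = |C'| for any permutations σ of C and σ'' of C'. -/
theorem aux_iter {n : ℕ} {C : Finset (Fin n)} {σ : Equiv.Perm {i // i ∈ C}} {M : Fin n → Fin n}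
    (hM : ∀ x : {i // i ∈ C}, M x.1 = (σ x).1) (k : ℕ) (x : {i // i ∈ C}) :
    M^[k] x.1 = ((σ ^ k) x).1 := by
  induction k generalizing x with
  | zero => simp
  | succ k ih => rw [Function.iterate_succ_apply, hM, ih, pow_succ, Equiv.Perm.mul_apply]

theorem aux_iff {n : ℕ} {C : Finset (Fin n)} {σ : Equiv.Perm {i // i ∈ C}} {M : Fin n → Fin n}
    (hM : ∀ x : {i // i ∈ C}, M x.1 = (σ x).1) :
    (∀ i : Fin n, (∃ k : ℕ, 1 ≤ k ∧ M^[k] i = i) ↔ i ∈ C) ↔ ∀ i, ∃ k : ℕ, M^[k] i ∈ C := by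
  constructor
  · intro h i
    obtain ⟨a, b, hab, he⟩ := Finite.exists_ne_map_eq_of_infinite (fun k : ℕ => M^[k] i)
    wlog hlt : a < b generalizing a b
    · exact this b a hab.symm he.symm (by omega)
    refine ⟨a, (h _).1 ⟨b - a, by omega, ?_⟩⟩
    rw [← Function.iterate_add_apply, Nat.sub_add_cancel hlt.le]
    exact he.symm
  · intro h i
    constructor
    · rintro ⟨k, hk, hi⟩
      obtain ⟨j, hj⟩ := h i
      have h1 : M^[k * j] i = i := by
        rw [Function.iterate_mul]
        exact Function.iterate_fixed hi j
      have h2 : j ≤ k * j := Nat.le_mul_of_pos_left j hk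
      rw [← h1, ← Nat.sub_add_cancel h2, Function.iterate_add_apply, aux_iter hM _ ⟨_, hj⟩]
      exact Subtype.prop _
    · intro hi
      refine ⟨orderOf σ, orderOf_pos σ, ?_⟩
      rw [aux_iter hM _ ⟨i, hi⟩, pow_orderOf_eq_one]
      rfl

theorem aux_le (n : ℕ) (C C' : Finset (Fin n)) (hcard : C.card = C'.card)
    (σ : Equiv.Perm {i // i ∈ C}) (σ'' : Equiv.Perm {i // i ∈ C'}) :
    Nat.card {M : Fin n → Fin n //
        (∀ i : Fin n, (∃ k : ℕ, 1 ≤ k ∧ M^[k] i = i) ↔ i ∈ C) ∧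
        ∀ x : {i // i ∈ C}, M x.1 = (σ x).1} ≤
    Nat.card {M : Fin n → Fin n //
        (∀ i : Fin n, (∃ k : ℕ, 1 ≤ k ∧ M^[k] i = i) ↔ i ∈ C') ∧
        ∀ x : {i // i ∈ C'}, M x.1 = (σ'' x).1} := by
  obtain ⟨e, he⟩ : ∃ e : Equiv.Perm (Fin n), ∀ i, e i ∈ C' ↔ i ∈ C := by
    let f := Finset.equivOfCardEq hcard
    refine ⟨f.extendSubtype, fun i => ⟨fun h => ?_, fun h => f.extendSubtype_mem i h⟩⟩
    by_contra hi
    exact f.extendSubtype_not_mem i hi h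
  let F : (Fin n → Fin n) → Fin n → Fin n := fun M y =>
    if h : y ∈ C' then (σ'' ⟨y, h⟩).1 else e (M (e.symm y))
  have hF1 : ∀ M, ∀ x : {i // i ∈ C'}, F M x.1 = (σ'' x).1 := fun M x => by simp [F]
  have hF2 : ∀ M i, i ∉ C → F M (e i) = e (M i) := fun M i hi => by simp [F, he, hi]
  have hF3 : ∀ M (k : ℕ) i, M^[k] i ∈ C → ∃ k' : ℕ, (F M)^[k'] (e i) ∈ C' := by
    intro M k
    induction k with
    | zero => exact fun i hi => ⟨0, (he i).2 hi⟩
    | succ k ih =>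
      intro i hi
      by_cases hc : i ∈ C
      · exact ⟨0, (he i).2 hc⟩
      · obtain ⟨k', hk'⟩ := ih (M i) hi
        exact ⟨k' + 1, by rwa [Function.iterate_succ_apply, hF2 M i hc]⟩
  refine Nat.card_le_card_of_injective (fun M => ⟨F M.1, (aux_iff (hF1 M.1)).2 fun y => ?_, hF1 M.1⟩) ?_
  · obtain ⟨k, hk⟩ := (aux_iff M.2.2).1 M.2.1 (e.symm y)
    simpa using hF3 M.1 k _ hk
  · intro M N h
    have h' : F M.1 = F N.1 := congrArg Subtype.val h
    ext1
    funext i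
    by_cases hi : i ∈ C
    · rw [M.2.2 ⟨i, hi⟩, N.2.2 ⟨i, hi⟩]
    · apply e.injective
      rw [← hF2 _ i hi, ← hF2 _ i hi, h']

/-- Symmetry property of uniform random mappings (Section 2.2 of Aldous–Pitman):
the number `N(C,σ)` of mappings `M : {1,…,n} → {1,…,n}` whose set of cyclic points
is exactly `C` and whose restriction to `C` is the permutation `σ` depends only on
`n` and the cardinality `|C|`. -/
theorem stmt_13 (n : ℕ) (hn : 1 ≤ n) (C C' : Finset (Fin n))
    (hC : C.Nonempty) (hC' : C'.Nonempty) (hcard : C.card = C'.card)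
    (σ : Equiv.Perm {i // i ∈ C}) (σ'' : Equiv.Perm {i // i ∈ C'}) :
    Nat.card {M : Fin n → Fin n //
        (∀ i : Fin n, (∃ k : ℕ, 1 ≤ k ∧ M^[k] i = i) ↔ i ∈ C) ∧
        ∀ x : {i // i ∈ C}, M x.1 = (σ x).1} =
    Nat.card {M : Fin n → Fin n //
        (∀ i : Fin n, (∃ k : ℕ, 1 ≤ k ∧ M^[k] i = i) ↔ i ∈ C') ∧
        ∀ x : {i // i ∈ C'}, M x.1 = (σ'' x).1} := by
  exact le_antisymm (aux_le n C C' hcard σ σ'') (aux_le n C' C hcard.symm σ'' σ)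
end
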